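/- Suppose γ' is obtained from γ by the transposition (T.7) applied at positions i<j<k<ℓ (replacing the matchings (i<j),(k<ℓ) by (i<k),(j<ℓ)). Then ℓ(γ') − ℓ(γ) = 1 if and only if every position m with j < m < k is either the right endpoint of a matching (a<m) of γ with a < i, or the left endpoint of a matching (m<b) of γ with b > ℓ. -/

import Mathlib

noncomputable section
open scoped Classical

/-- A `(p,q)`-clan: a partial matching of `{0,…,p+q-1}` (encoded by the involution `mate`)
together with a sign (`true` = `+`, `false` = `-`) at each unmatched position, such that
`#(+) - #(-) = p - q`.  Matched positions carry the junk sign `true`. -/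
structure Clan (p q : ℕ) where
  mate : Fin (p + q) → Fin (p + q)
  mate_invol : ∀ i, mate (mate i) = i
  sign : Fin (p + q) → Bool
  sign_matched : ∀ i, mate i ≠ i → sign i = true
  plus_minus :
    (Finset.univ.filter fun i => mate i = i ∧ sign i = true).card + q
      = (Finset.univ.filter fun i => mate i = i ∧ sign i = false).card + p

namespace Clan

variable {p q r s : ℕ}

/-- position `i` carries a `+`. -/
def IsPlus (c : Clan p q) (i : Fin (p + q)) : Prop :=
  c.mate i = i ∧ c.sign i = true

/-- position `i` carries a `-`. -/
def IsMinus (c : Clan p q) (i : Fin (p + q)) : Prop :=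
  c.mate i = i ∧ c.sign i = false

/-- position `i` is the left end of a matching. -/
def IsLeft (c : Clan p q) (i : Fin (p + q)) : Prop :=
  i < c.mate i

/-- position `i` is the right end of a matching. -/
def IsRight (c : Clan p q) (i : Fin (p + q)) : Prop :=
  c.mate i < i

/-- `(i < j)` is a matching of the clan `c`. -/
def IsMatch (c : Clan p q) (i j : Fin (p + q)) : Prop :=
  i < j ∧ c.mate i = j

/-- The length `ℓ(c)` of a clan:
`ℓ(c) = Σ_{(i<j) matching} (j - i - #{matchings (s<t) with s < i < t < j})`. -/
def len (c : Clan p q) : ℤ :=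
  ∑ ij ∈ Finset.univ.filter (fun ij : Fin (p + q) × Fin (p + q) => c.IsMatch ij.1 ij.2),
    (((ij.2 : ℕ) : ℤ) - ((ij.1 : ℕ) : ℤ) -
      ((Finset.univ.filter (fun st : Fin (p + q) × Fin (p + q) =>
          c.IsMatch st.1 st.2 ∧ st.1 < ij.1 ∧ ij.1 < st.2 ∧ st.2 < ij.2)).card : ℤ))

/-- `c` and `c'` agree (same symbols, same matchings) at every position outside `S`. -/
def AgreeOutside (c c' : Clan p q) (S : Set (Fin (p + q))) : Prop :=
  ∀ i, i ∉ S → c.mate i = c'.mate i ∧ c.sign i = c'.sign i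

/-- `c'` is obtained from `c` by one of the transpositions (T.1)–(T.10). -/
def Transposition (c c' : Clan p q) : Prop :=
  -- (T.1)  +- ↦ 11
  (∃ a b, a < b ∧ c.IsPlus a ∧ c.IsMinus b ∧ c'.IsMatch a b ∧
      AgreeOutside c c' {a, b}) ∨
  -- (T.2)  -+ ↦ 11
  (∃ a b, a < b ∧ c.IsMinus a ∧ c.IsPlus b ∧ c'.IsMatch a b ∧
      AgreeOutside c c' {a, b}) ∨
  -- (T.3)  11+ ↦ 1+1
  (∃ a b d, c.IsMatch a b ∧ b < d ∧ c.IsPlus d ∧ c'.IsMatch a d ∧ c'.IsPlus b ∧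
      AgreeOutside c c' {a, b, d}) ∨
  -- (T.4)  11- ↦ 1-1
  (∃ a b d, c.IsMatch a b ∧ b < d ∧ c.IsMinus d ∧ c'.IsMatch a d ∧ c'.IsMinus b ∧
      AgreeOutside c c' {a, b, d}) ∨
  -- (T.5)  +11 ↦ 1+1
  (∃ a b d, c.IsPlus a ∧ a < b ∧ c.IsMatch b d ∧ c'.IsMatch a d ∧ c'.IsPlus b ∧
      AgreeOutside c c' {a, b, d}) ∨
  -- (T.6)  -11 ↦ 1-1
  (∃ a b d, c.IsMinus a ∧ a < b ∧ c.IsMatch b d ∧ c'.IsMatch a d ∧ c'.IsMinus b ∧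
      AgreeOutside c c' {a, b, d}) ∨
  -- (T.7)  1122 ↦ 1212
  (∃ i j k l, c.IsMatch i j ∧ j < k ∧ c.IsMatch k l ∧ c'.IsMatch i k ∧ c'.IsMatch j l ∧
      AgreeOutside c c' {i, j, k, l}) ∨
  -- (T.8)  1122 ↦ 1+-1
  (∃ i j k l, c.IsMatch i j ∧ j < k ∧ c.IsMatch k l ∧ c'.IsMatch i l ∧ c'.IsPlus j ∧
      c'.IsMinus k ∧ AgreeOutside c c' {i, j, k, l}) ∨
  -- (T.9)  1122 ↦ 1-+1
  (∃ i j k l, c.IsMatch i j ∧ j < k ∧ c.IsMatch k l ∧ c'.IsMatch i l ∧ c'.IsMinus j ∧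
      c'.IsPlus k ∧ AgreeOutside c c' {i, j, k, l}) ∨
  -- (T.10) 1212 ↦ 1221
  (∃ i j k l, i < j ∧ j < k ∧ k < l ∧ c.IsMatch i k ∧ c.IsMatch j l ∧ c'.IsMatch i l ∧
      c'.IsMatch j k ∧ AgreeOutside c c' {i, j, k, l})

/-- Bruhat order `≤` on clans: generated by transpositions. -/
def ble (c c' : Clan p q) : Prop :=
  Relation.ReflTransGen Transposition c c'

/-- Strict Bruhat order `<` on clans. -/
def blt (c c' : Clan p q) : Prop :=
  Relation.TransGen Transposition c c'

/-- Covering relation: `c ⋖ c'` iff `c < c'` and `ℓ(c') = ℓ(c) + 1`. -/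
def Covers (c c' : Clan p q) : Prop :=
  blt c c' ∧ c'.len = c.len + 1

/-- `θ` pattern contains `γ` via the strictly increasing index map `ι`. -/
def Pattern (θ : Clan r s) (γ : Clan p q) (ι : Fin (p + q) → Fin (r + s)) : Prop :=
  StrictMono ι ∧
  (∀ j, γ.mate j = j → θ.mate (ι j) = ι j ∧ θ.sign (ι j) = γ.sign j) ∧
  (∀ k l, γ.IsMatch k l → θ.IsMatch (ι k) (ι l))

/-- `φ` agrees with `θ` at every position outside the range of `ι`. -/
def AgreesWithOutside (φ θ : Clan r s) (ι : Fin (p + q) → Fin (r + s)) : Prop :=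
  ∀ m, (∀ k, ι k ≠ m) → φ.mate m = θ.mate m ∧ φ.sign m = θ.sign m

/-- `[α,γ]` interval pattern embeds into `[β,θ]` via `ι`. -/
def IntervalEmbed (α γ : Clan p q) (β θ : Clan r s)
    (ι : Fin (p + q) → Fin (r + s)) : Prop :=
  Pattern θ γ ι ∧ Pattern β α ι ∧ AgreesWithOutside β θ ι ∧
  θ.len - β.len = γ.len - α.len

/-- `θ` interval pattern contains `[α,γ]`. -/
def IntervalContains (θ : Clan r s) (α γ : Clan p q) : Prop :=
  ∃ (ι : Fin (p + q) → Fin (r + s)) (φ : Clan r s), IntervalEmbed α γ φ θ ι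

/-- `γ(i;+)` (here `i` is the number of initial positions considered, i.e. `i` is 1-indexed):
number of `+`'s plus number of matchings entirely among the first `i` positions. -/
def statPlus (c : Clan p q) (i : ℕ) : ℕ :=
  (Finset.univ.filter fun j : Fin (p + q) => (j : ℕ) < i ∧ c.IsPlus j).card +
  (Finset.univ.filter fun ab : Fin (p + q) × Fin (p + q) =>
      c.IsMatch ab.1 ab.2 ∧ (ab.2 : ℕ) < i).card

/-- `γ(i;-)`, as in `statPlus` with `-`'s. -/
def statMinus (c : Clan p q) (i : ℕ) : ℕ :=
  (Finset.univ.filter fun j : Fin (p + q) => (j : ℕ) < i ∧ c.IsMinus j).card +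
  (Finset.univ.filter fun ab : Fin (p + q) × Fin (p + q) =>
      c.IsMatch ab.1 ab.2 ∧ (ab.2 : ℕ) < i).card

/-- `γ(i;j)` (with `i < j` 1-indexed): number of matchings with left endpoint weakly left
of `i` and right endpoint strictly right of `j`. -/
def statMid (c : Clan p q) (i j : ℕ) : ℕ :=
  (Finset.univ.filter fun ab : Fin (p + q) × Fin (p + q) =>
      c.IsMatch ab.1 ab.2 ∧ (ab.1 : ℕ) < i ∧ j ≤ (ab.2 : ℕ)).card

/-- The permutation `w_c` associated to a clan `c`, 0-indexed: positions carrying a `+` or a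
left endpoint get (in left-to-right order) the values `0,…,p-1`; the remaining values
`p,…,p+q-1` are assigned, scanning left to right, to each `-` as it is encountered and to the
right end of each matching as soon as its left end is encountered. -/
def wNat (c : Clan p q) (i : Fin (p + q)) : ℕ :=
  if c.IsPlus i ∨ c.IsLeft i then
    (Finset.univ.filter fun j : Fin (p + q) => (c.IsPlus j ∨ c.IsLeft j) ∧ j < i).card
  else
    p + (Finset.univ.filter fun j : Fin (p + q) =>
        (c.IsMinus j ∨ c.IsLeft j) ∧ j < (if c.IsMinus i then i else c.mate i)).card

/-- Membership in the affine space `S_c`: the conditions (O.1)–(O.3) and (Z.1)–(Z.9). -/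
def MemS (c : Clan p q) (M : Matrix (Fin (p + q)) (Fin (p + q)) ℂ) : Prop :=
  -- (O.1)
  (∀ i j : Fin (p + q), c.mate i = i → (j : ℕ) = c.wNat i → M i j = 1) ∧
  -- (O.2)
  (∀ i i' j : Fin (p + q), c.IsMatch i i' →
      ((j : ℕ) = c.wNat i ∨ (j : ℕ) = c.wNat i') → M i j = 1) ∧
  -- (O.3)
  (∀ i i' j : Fin (p + q), c.IsMatch i i' → (j : ℕ) = c.wNat i → M i' j = -1) ∧
  (∀ i i' j : Fin (p + q), c.IsMatch i i' → (j : ℕ) = c.wNat i' → M i' j = 1) ∧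
  -- (Z.1): first p columns, rows containing a pivot (rows of +'s and of left endpoints)
  (∀ i j : Fin (p + q), (c.IsPlus i ∨ c.IsLeft i) → (j : ℕ) < p →
      (j : ℕ) ≠ c.wNat i → M i j = 0) ∧
  -- (Z.2): above a pivot, first p columns
  (∀ i x j : Fin (p + q), (c.IsPlus i ∨ c.IsLeft i) → (j : ℕ) = c.wNat i →
      x < i → M x j = 0) ∧
  -- (Z.3): between the pivot 1 and the -1 of a column
  (∀ i i' x j : Fin (p + q), c.IsMatch i i' → (j : ℕ) = c.wNat i →
      i < x → x < i' → M x j = 0) ∧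
  -- (Z.4): right of a -1, within the first p columns
  (∀ i i' j : Fin (p + q), c.IsMatch i i' → c.wNat i < (j : ℕ) → (j : ℕ) < p →
      M i' j = 0) ∧
  -- (Z.5): last q columns, rows containing a pivot (rows of -'s and of left endpoints)
  (∀ i j : Fin (p + q), c.IsMinus i → p ≤ (j : ℕ) → (j : ℕ) ≠ c.wNat i → M i j = 0) ∧
  (∀ i i' j : Fin (p + q), c.IsMatch i i' → p ≤ (j : ℕ) → (j : ℕ) ≠ c.wNat i' →
      M i j = 0) ∧
  -- (Z.6): above a pivot, last q columns
  (∀ i x j : Fin (p + q), c.IsMinus i → (j : ℕ) = c.wNat i → x < i → M x j = 0) ∧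
  (∀ i i' x j : Fin (p + q), c.IsMatch i i' → (j : ℕ) = c.wNat i' → x < i → M x j = 0) ∧
  -- (Z.7): between the pivot 1 and the second 1 of a column
  (∀ i i' x j : Fin (p + q), c.IsMatch i i' → (j : ℕ) = c.wNat i' →
      i < x → x < i' → M x j = 0) ∧
  -- (Z.8): right of a second-1-of-its-column
  (∀ i i' j : Fin (p + q), c.IsMatch i i' → c.wNat i' < (j : ℕ) → M i' j = 0) ∧
  -- (Z.9): identification for 1212 patterns
  (∀ i j k l ci ck : Fin (p + q), c.IsMatch i k → c.IsMatch j l →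
      i < j → j < k → k < l → (ci : ℕ) = c.wNat i → (ck : ℕ) = c.wNat k →
      M l ck = - M l ci)

/-- Rank of the southwest `(n-i) × p` submatrix of `M` (`i` 1-indexed from `1` to `n`). -/
def swRank (p q : ℕ) (M : Matrix (Fin (p + q)) (Fin (p + q)) ℂ) (i : ℕ) : ℕ :=
  Matrix.rank (Matrix.of fun (x : Fin (p + q - i)) (y : Fin p) =>
    M ⟨i + (x : ℕ), by have := x.isLt; omega⟩ ⟨(y : ℕ), by have := y.isLt; omega⟩)

/-- Rank of the southeast `(n-i) × q` submatrix of `M`. -/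
def seRank (p q : ℕ) (M : Matrix (Fin (p + q)) (Fin (p + q)) ℂ) (i : ℕ) : ℕ :=
  Matrix.rank (Matrix.of fun (x : Fin (p + q - i)) (y : Fin q) =>
    M ⟨i + (x : ℕ), by have := x.isLt; omega⟩ ⟨p + (y : ℕ), by have := y.isLt; omega⟩)

/-- Rank of the auxiliary matrix `M^{[i;j]}`: its first `i` columns are the first `i` columns
of `M⁻¹` with the last `q` rows zeroed out, its last `j` columns are the first `j` columns
of `M⁻¹`. -/
def auxRank (p q : ℕ) (M : Matrix (Fin (p + q)) (Fin (p + q)) ℂ) (i j : ℕ) : ℕ :=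
  Matrix.rank (Matrix.of fun (x : Fin (p + q)) (y : Fin i ⊕ Fin j) =>
    Sum.elim
      (fun a : Fin i =>
        if p ≤ (x : ℕ) then (0 : ℂ)
        else if h : (a : ℕ) < p + q then M⁻¹ x ⟨(a : ℕ), h⟩ else 0)
      (fun b : Fin j =>
        if h : (b : ℕ) < p + q then M⁻¹ x ⟨(b : ℕ), h⟩ else 0) y)

/-- The Mars–Springer variety `N_{θ,c}`: matrices of `S_c` satisfying the rank
conditions (R.1)–(R.3) attached to `θ`. -/
def MarsSpringer (θ c : Clan p q) (M : Matrix (Fin (p + q)) (Fin (p + q)) ℂ) : Prop :=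
  MemS c M ∧
  (∀ i : ℕ, 1 ≤ i → i ≤ p + q → swRank p q M i ≤ p - statPlus θ i) ∧
  (∀ i : ℕ, 1 ≤ i → i ≤ p + q → seRank p q M i ≤ q - statMinus θ i) ∧
  (∀ i j : ℕ, 1 ≤ i → i < j → j ≤ p + q → auxRank p q M i j ≤ j + statMid θ i j)

/-- The linear relations defining the coordinates `λ_{k,a}`:
`e_k + Σ_{a ≥ p} λ_{k,a} v_a = Σ_{a < p} λ_{k,a} v_a`, where `v_a` are the columns of `M`. -/
def LambdaRel (p q : ℕ) (M : Matrix (Fin (p + q)) (Fin (p + q)) ℂ)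
    (lam : Fin (p + q) → Fin (p + q) → ℂ) : Prop :=
  ∀ k x : Fin (p + q),
    (if x = k then (1 : ℂ) else 0) +
        ∑ a ∈ Finset.univ.filter (fun a : Fin (p + q) => p ≤ (a : ℕ)), lam k a * M x a
      = ∑ a ∈ Finset.univ.filter (fun a : Fin (p + q) => (a : ℕ) < p), lam k a * M x a

/-- The base point of `S_c`: all free entries set to `0`. -/
def basePoint (c : Clan p q) : Matrix (Fin (p + q)) (Fin (p + q)) ℂ :=
  Matrix.of fun i j =>
    if (j : ℕ) = c.wNat i then 1
    else if c.mate i ≠ i ∧ (j : ℕ) = c.wNat (c.mate i) then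
      (if c.mate i < i then -1 else 1)
    else 0

/-- The diagonal matrix `I_{p,q}` with `p` ones followed by `q` negative ones. -/
def Ipq (p q : ℕ) : Matrix (Fin (p + q)) (Fin (p + q)) ℂ :=
  Matrix.diagonal fun i => if (i : ℕ) < p then 1 else -1

end Clan

namespace Clan

variable {p q : ℕ}

theorem sum_isMatch (c : Clan p q) (g : Fin (p + q) → Fin (p + q) → ℤ) :
    ∑ ij ∈ Finset.univ.filter (fun ij : Fin (p + q) × Fin (p + q) => c.IsMatch ij.1 ij.2),
      g ij.1 ij.2 = ∑ x, if x < c.mate x then g x (c.mate x) else 0 := by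
  rw [Finset.sum_filter, Fintype.sum_prod_type]
  refine Finset.sum_congr rfl fun x _ => ?_
  rw [Finset.sum_eq_single (c.mate x)]
  · simp [IsMatch]
  · intro b _ hb
    exact if_neg fun h => hb h.2.symm
  · simp

/-- The indicator that the arc with left end `s` starts before and crosses the arc with left end
`x`. -/
def crossing (c : Clan p q) (x s : Fin (p + q)) : ℤ :=
  if s < x ∧ x < c.mate s ∧ c.mate s < c.mate x then 1 else 0

/-- The length of the arc with left end `x`, and `0` if `x` is not a left end. -/
def arcLength (c : Clan p q) (x : Fin (p + q)) : ℤ :=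
  if x < c.mate x then ((c.mate x : ℕ) : ℤ) - ((x : ℕ) : ℤ) else 0

theorem len_eq_sum (c : Clan p q) :
    c.len = ∑ x, c.arcLength x - ∑ x, ∑ s, c.crossing x s := by
  have hcard : ∀ x y : Fin (p + q),
      ((Finset.univ.filter (fun st : Fin (p + q) × Fin (p + q) =>
          c.IsMatch st.1 st.2 ∧ st.1 < x ∧ x < st.2 ∧ st.2 < y)).card : ℤ)
        = ∑ s, if s < x ∧ x < c.mate s ∧ c.mate s < y then 1 else 0 := by
    intro x y
    rw [← Finset.filter_filter, Finset.card_filter, Nat.cast_sum]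
    have h := c.sum_isMatch fun s t => if s < x ∧ x < t ∧ t < y then 1 else 0
    simp only [Nat.cast_ite, Nat.cast_one, Nat.cast_zero]
    rw [h]
    refine Finset.sum_congr rfl fun s _ => ?_
    grind
  unfold len
  simp only [hcard]
  rw [c.sum_isMatch fun x y => ((y : ℕ) : ℤ) - ((x : ℕ) : ℤ) -
    ∑ s, if s < x ∧ x < c.mate s ∧ c.mate s < y then 1 else 0, ← Finset.sum_sub_distrib]
  refine Finset.sum_congr rfl fun x _ => ?_
  unfold arcLength crossing
  split_ifs with h
  · rfl
  · rw [Finset.sum_eq_zero, sub_zero]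
    intro s _
    grind

theorem sum_comp_mate (c : Clan p q) (f : Fin (p + q) → ℤ) :
    ∑ x, f (c.mate x) = ∑ x, f x :=
  Equiv.sum_comp (Function.Involutive.toPerm c.mate c.mate_invol) f

end Clan

/-- If `E` vanishes off the rows and columns in `P`, its total is the block sum over `P` plus the
sum of the off-diagonal blocks. -/
theorem sum_sum_eq_of_eq_zero_compl {α : Type*} [Fintype α] [DecidableEq α]
    (P : Finset α) (E : α → α → ℤ)
    (h : ∀ x ∉ P, ∀ s ∉ P, E x s = 0) :
    ∑ x, ∑ s, E x s = ∑ x ∈ P, ∑ s ∈ P, E x s +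
      ∑ s ∈ Pᶜ, ∑ x ∈ P, (E x s + E s x) := by
  have hR : ∑ x ∈ Pᶜ, ∑ s ∈ Pᶜ, E x s = 0 :=
    Finset.sum_eq_zero fun x hx => Finset.sum_eq_zero fun s hs =>
      h x (Finset.mem_compl.1 hx) s (Finset.mem_compl.1 hs)
  simp only [← Finset.sum_add_sum_compl P, Finset.sum_add_distrib, hR]
  rw [Finset.sum_comm (s := P) (t := Pᶜ)]
  ring

/-- The indicator that the chord `{s, t}`, with `s` its left end, crosses the chord `(a < b)`. -/
def chordCross {n : ℕ} (a b s t : Fin n) : ℤ :=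
  (if s < a ∧ a < t ∧ t < b then 1 else 0) + (if a < s ∧ s < b ∧ b < t then 1 else 0)

/-- Twice the indicator that `s` lies in `(j, k)` while `t` lies outside `[i, l]`. -/
def escape {n : ℕ} (i j k l s t : Fin n) : ℤ :=
  if j < s ∧ s < k ∧ (t < i ∨ l < t) then 2 else 0

theorem chordCross_add_swap {n : ℕ} {a b s t : Fin n} (hsa : s ≠ a) (hsb : s ≠ b)
    (hta : t ≠ a) (htb : t ≠ b) :
    chordCross a b s t + chordCross a b t s =
      if (a < s ∧ s < b) ↔ (a < t ∧ t < b) then 0 else 1 := by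
  unfold chordCross
  grind

theorem chordCross_uncross {n : ℕ} {i j k l s t : Fin n} (hij : i < j) (hjk : j < k) (hkl : k < l)
    (hsi : s ≠ i) (hsj : s ≠ j) (hsk : s ≠ k) (hsl : s ≠ l)
    (hti : t ≠ i) (htj : t ≠ j) (htk : t ≠ k) (htl : t ≠ l) :
    (chordCross i k s t + chordCross j l s t - chordCross i j s t - chordCross k l s t) +
      (chordCross i k t s + chordCross j l t s - chordCross i j t s - chordCross k l t s) =
    escape i j k l s t + escape i j k l t s := by
  have h1 := chordCross_add_swap hsi hsk hti htk
  have h2 := chordCross_add_swap hsj hsl htj htl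
  have h3 := chordCross_add_swap hsi hsj hti htj
  have h4 := chordCross_add_swap hsk hsl htk htl
  unfold escape
  grind (splits := 30)

namespace Clan

variable {p q : ℕ}

theorem IsMatch.mate_right {c : Clan p q} {x y : Fin (p + q)} (h : c.IsMatch x y) :
    c.mate y = x := by
  rw [← h.2, c.mate_invol]

theorem IsMatch.crossing_add_crossing {c : Clan p q} {x y : Fin (p + q)} (h : c.IsMatch x y)
    (s : Fin (p + q)) :
    c.crossing x s + c.crossing s x + (c.crossing y s + c.crossing s y) =
      chordCross x y s (c.mate s) := by
  have hx := h.2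
  have hy := h.mate_right
  have hxy := h.1
  simp only [crossing, chordCross, hx, hy]
  grind

theorem len_sub_len_of_t7 {c c' : Clan p q} {i j k l : Fin (p + q)}
    (hij : c.IsMatch i j) (hjk : j < k) (hkl : c.IsMatch k l)
    (hik : c'.IsMatch i k) (hjl : c'.IsMatch j l)
    (hagree : AgreeOutside c c' {i, j, k, l}) :
    c'.len - c.len = 2 * (((k : ℕ) : ℤ) - ((j : ℕ) : ℤ)) - 1 -
      ∑ s, escape i j k l s (c.mate s) := by
  have ⟨hi, hj, hk, hl⟩ :=
    (⟨hij.2, hij.mate_right, hkl.2, hkl.mate_right⟩ :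
      c.mate i = j ∧ c.mate j = i ∧ c.mate k = l ∧ c.mate l = k)
  have ⟨hi', hj', hk', hl'⟩ :=
    (⟨hik.2, hjl.2, hik.mate_right, hjl.mate_right⟩ :
      c'.mate i = k ∧ c'.mate j = l ∧ c'.mate k = i ∧ c'.mate l = j)
  have lij := hij.1
  have lkl := hkl.1
  set P : Finset (Fin (p + q)) := {i, j, k, l} with hP
  have memP : ∀ x, x ∈ P ↔ x = i ∨ x = j ∨ x = k ∨ x = l := by simp [hP]
  have hmate : ∀ x ∉ P, c'.mate x = c.mate x := fun x hx =>
    ((hagree x (by simpa [hP] using hx)).1).symm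
  have hPmate : ∀ x, c.mate x ∈ P ↔ x ∈ P := by
    have h : ∀ x, x ∈ P → c.mate x ∈ P := by
      intro x hx
      rw [memP] at hx ⊢
      rcases hx with rfl | rfl | rfl | rfl <;> simp [*]
    exact fun x => ⟨fun hx => c.mate_invol x ▸ h _ hx, h x⟩
  have sumP : ∀ f : Fin (p + q) → ℤ, ∑ x ∈ P, f x = f i + f j + f k + f l := by
    intro f
    rw [hP, Finset.sum_insert (by simp; grind), Finset.sum_insert (by simp; grind),
      Finset.sum_insert (by simp; grind), Finset.sum_singleton]
    ring
  have harc : ∑ x, (c'.arcLength x - c.arcLength x) =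
      2 * (((k : ℕ) : ℤ) - ((j : ℕ) : ℤ)) := by
    rw [← Finset.sum_subset (Finset.subset_univ P)
      (fun x _ hx => by simp [arcLength, hmate x hx]), sumP]
    simp only [arcLength, hi, hj, hk, hl, hi', hj', hk', hl']
    grind
  let δ : Fin (p + q) → Fin (p + q) → ℤ := fun s t =>
    chordCross i k s t + chordCross j l s t - chordCross i j s t - chordCross k l s t
  have hcross : ∑ x, ∑ s, (c'.crossing x s - c.crossing x s) =
      1 + ∑ s ∈ Pᶜ, δ s (c.mate s) := by
    rw [sum_sum_eq_of_eq_zero_compl P _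
      (fun x hx s hs => by simp [crossing, hmate x hx, hmate s hs])]
    congr 1
    · simp only [sumP, crossing, hi, hj, hk, hl, hi', hj', hk', hl']
      grind
    · refine Finset.sum_congr rfl fun s hs => ?_
      have hs := Finset.mem_compl.1 hs
      have e1 := hij.crossing_add_crossing s
      have e2 := hkl.crossing_add_crossing s
      have e3 := hik.crossing_add_crossing s
      have e4 := hjl.crossing_add_crossing s
      rw [hmate s hs] at e3 e4
      simp only [sumP, δ]
      linarith
  have hsym : ∑ s ∈ Pᶜ, δ s (c.mate s) = ∑ s ∈ Pᶜ, escape i j k l s (c.mate s) := by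
    have swap : ∀ f : Fin (p + q) → Fin (p + q) → ℤ,
        ∑ s ∈ Pᶜ, f (c.mate s) s = ∑ s ∈ Pᶜ, f s (c.mate s) := by
      intro f
      have h := c.sum_comp_mate fun x => if x ∈ Pᶜ then f x (c.mate x) else 0
      simp only [Finset.mem_compl, hPmate, c.mate_invol] at h
      simpa only [← Finset.mem_compl, ← Finset.sum_filter, Finset.filter_univ_mem] using h
    have key : ∑ s ∈ Pᶜ, (δ s (c.mate s) + δ (c.mate s) s) =
        ∑ s ∈ Pᶜ, (escape i j k l s (c.mate s) + escape i j k l (c.mate s) s) := by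
      refine Finset.sum_congr rfl fun s hs => ?_
      have hs := Finset.mem_compl.1 hs
      have hs' := mt (hPmate s).1 hs
      simp only [memP, not_or] at hs hs'
      exact chordCross_uncross lij hjk lkl hs.1 hs.2.1 hs.2.2.1 hs.2.2.2
        hs'.1 hs'.2.1 hs'.2.2.1 hs'.2.2.2
    rw [Finset.sum_add_distrib, Finset.sum_add_distrib, swap, swap (escape i j k l)] at key
    linarith
  have hesc : ∑ s ∈ Pᶜ, escape i j k l s (c.mate s) = ∑ s, escape i j k l s (c.mate s) := by
    refine Finset.sum_subset (Finset.subset_univ _) fun s _ hs => ?_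
    rw [Finset.mem_compl, not_not, memP] at hs
    unfold escape
    rcases hs with rfl | rfl | rfl | rfl <;> simp only [*] <;> grind
  simp only [Finset.sum_sub_distrib] at harc hcross
  rw [len_eq_sum, len_eq_sum]
  linarith

end Clan

/-- (T.7) is a cover (raises length by exactly one) iff every position strictly
between `j` and `k` is the right end of a matching starting before `i` or the left end of a
matching ending after `l`. -/
theorem t7_cover_iff {p q : ℕ} (c c' : Clan p q) (i j k l : Fin (p + q))
    (hij : c.IsMatch i j) (hjk : j < k) (hkl : c.IsMatch k l)
    (hik : c'.IsMatch i k) (hjl : c'.IsMatch j l)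
    (hagree : Clan.AgreeOutside c c' {i, j, k, l}) :
    c'.len = c.len + 1 ↔
      ∀ m : Fin (p + q), j < m → m < k →
        (∃ a, a < i ∧ c.IsMatch a m) ∨ (∃ b, l < b ∧ c.IsMatch m b) := by
  have hlen := Clan.len_sub_len_of_t7 hij hjk hkl hik hjl hagree
  have hIoo : ∑ s : Fin (p + q), (if j < s ∧ s < k then (2 : ℤ) else 0) =
      2 * (((k : ℕ) : ℤ) - ((j : ℕ) : ℤ) - 1) := by
    have h : Finset.univ.filter (fun s => j < s ∧ s < k) = Finset.Ioo j k := by ext; simp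
    rw [← Finset.sum_filter, h, Finset.sum_const, Fin.card_Ioo, nsmul_eq_mul]
    have := Fin.lt_def.1 hjk
    omega
  have hnonneg : ∀ s ∈ Finset.univ, 0 ≤ (if j < s ∧ s < k then (2 : ℤ) else 0) -
      escape i j k l s (c.mate s) := by
    intro s _
    unfold escape
    grind
  have hzero := Finset.sum_eq_zero_iff_of_nonneg hnonneg
  rw [Finset.sum_sub_distrib, hIoo] at hzero
  have hiff : c'.len = c.len + 1 ↔ 2 * (((k : ℕ) : ℤ) - ((j : ℕ) : ℤ) - 1) -
      ∑ s, escape i j k l s (c.mate s) = 0 := by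
    constructor <;> intro h <;> linarith
  rw [hiff, hzero]
  have lij := hij.1
  have lkl := hkl.1
  refine forall_congr' fun m => ?_
  have hmatch : ((∃ a, a < i ∧ c.IsMatch a m) ∨ (∃ b, l < b ∧ c.IsMatch m b)) ↔
      (c.mate m < i ∧ c.mate m < m) ∨ (l < c.mate m ∧ m < c.mate m) := by
    refine or_congr ⟨?_, fun h => ⟨_, h.1, h.2, c.mate_invol m⟩⟩
      ⟨?_, fun h => ⟨_, h.1, h.2, rfl⟩⟩
    · rintro ⟨a, ha, h⟩
      rw [h.mate_right]
      exact ⟨ha, h.1⟩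
    · rintro ⟨b, hb, h⟩
      rw [h.2]
      exact ⟨hb, h.1⟩
  rw [hmatch]
  unfold escape
  simp only [Finset.mem_univ, forall_const]
  grind
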